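/- arXiv:1605.08989 — 2 statements merged into one kernel-verified Lean document; each statement's English description precedes it below -/
import Mathlib

section
/- Let λ > 0, let (X₁, r₁, μ₁) and (X₂, r₂, μ₂) be probability mm spaces, and let Q be a coupling of μ₁ and μ₂ that attains the infimum in the definition of dEur^λ((X₁,r₁,μ₁),(X₂,r₂,μ₂)). Define r̄ on X₁ × X₂ by r̄((x₁,x₂),(x₁',x₂')) := max(r₁(x₁,x₁'), r₂(x₂,x₂')) and z̄ := (X₁ × X₂, r̄, Q). Then dEur^λ((X₁,r₁,μ₁),(X₂,r₂,μ₂)) = dEur^λ((X₁,r₁,μ₁), z̄) + dEur^λ(z̄, (X₂,r₂,μ₂)). -/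
open MeasureTheory Metric Filter Topology

namespace MMOrder

/-- The support of a Borel measure on a metric space: the set of points all of whose
open balls have positive mass. -/
def msupp {X : Type*} [MeasurableSpace X] [MetricSpace X] (μ : Measure X) : Set X :=
  {x : X | ∀ ε : ℝ, 0 < ε → 0 < μ (Metric.ball x ε)}

/-- `τ` is a measure-preserving sub-isometry from `(Y, r_Y, μY)` to `(X, r_X, μX)`:
it maps `supp μY` into `supp μX`, pushes `μY` forward to `μX`, and is `1`-Lipschitz
on the support of `μY`. -/
def IsMPSubIsom {X Y : Type*} [MeasurableSpace X] [MetricSpace X]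
    [MeasurableSpace Y] [MetricSpace Y] (μX : Measure X) (μY : Measure Y) (τ : Y → X) : Prop :=
  Measurable τ ∧ Set.MapsTo τ (msupp μY) (msupp μX) ∧ μY.map τ = μX ∧
    ∀ y₁ ∈ msupp μY, ∀ y₂ ∈ msupp μY, dist (τ y₁) (τ y₂) ≤ dist y₁ y₂

/-- `(X, r_X, μX) ≼_metric (Y, r_Y, μY)`: there is a measure-preserving sub-isometry
from `(Y, r_Y, μY)` to `(X, r_X, μX)`. -/
def LeMetric {X Y : Type*} [MeasurableSpace X] [MetricSpace X]
    [MeasurableSpace Y] [MetricSpace Y] (μX : Measure X) (μY : Measure Y) : Prop :=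
  ∃ τ : Y → X, IsMPSubIsom μX μY τ

/-- `(X, r_X, μX) ≼ (Y, r_Y, μY)`: there is a Borel measure `μY' ≤ μY` on `Y` and a
measure-preserving sub-isometry from `(Y, r_Y, μY')` to `(X, r_X, μX)`. -/
def LeGen {X Y : Type*} [MeasurableSpace X] [MetricSpace X]
    [MeasurableSpace Y] [MetricSpace Y] (μX : Measure X) (μY : Measure Y) : Prop :=
  ∃ μY' : Measure Y, μY' ≤ μY ∧ LeMetric μX μY'

/-- `(X, r_X, μX) ≼_measure (Y, r_Y, μY)`: there is an isometry `τ` on `supp μY`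
with `μX ≤ μY ∘ τ⁻¹`. -/
def LeMeasure {X Y : Type*} [MeasurableSpace X] [MetricSpace X]
    [MeasurableSpace Y] [MetricSpace Y] (μX : Measure X) (μY : Measure Y) : Prop :=
  ∃ τ : Y → X, Measurable τ ∧
    (∀ y₁ ∈ msupp μY, ∀ y₂ ∈ msupp μY, dist (τ y₁) (τ y₂) = dist y₁ y₂) ∧
    μX ≤ μY.map τ

/-- Two mm spaces are equivalent: there is a measurable map `φ : X → Y` pushing `μX`
forward to `μY` which restricts to an isometry on `supp μX` (onto its image). -/
def MMEquiv {X Y : Type*} [MeasurableSpace X] [MetricSpace X]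
    [MeasurableSpace Y] [MetricSpace Y] (μX : Measure X) (μY : Measure Y) : Prop :=
  ∃ φ : X → Y, Measurable φ ∧ μX.map φ = μY ∧
    ∀ x₁ ∈ msupp μX, ∀ x₂ ∈ msupp μX, dist (φ x₁) (φ x₂) = dist x₁ x₂

/-- Index set for the entries of a distance matrix of order `m`:
pairs `(i, j)` with `i < j`; it has `m(m-1)/2` elements, so `DIdx m → ℝ` is
`ℝ^{m(m-1)/2}` with its coordinatewise partial order. -/
def DIdx (m : ℕ) : Type := {p : Fin m × Fin m // p.1 < p.2}

instance (m : ℕ) : MeasurableSpace (DIdx m → ℝ) := by unfold DIdx; infer_instance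
instance (m : ℕ) : PartialOrder (DIdx m → ℝ) := by unfold DIdx; infer_instance

/-- The distance matrix map of order `m`. -/
def distMatMap {X : Type*} [MetricSpace X] (m : ℕ) (x : Fin m → X) : DIdx m → ℝ :=
  fun p => dist (x p.val.1) (x p.val.2)

/-- The distance matrix measure of order `m`: the pushforward of `μ^{⊗ m}` under the
distance matrix map. -/
noncomputable def nuM {X : Type*} [MeasurableSpace X] [MetricSpace X]
    (μ : Measure X) (m : ℕ) : Measure (DIdx m → ℝ) :=
  (Measure.pi fun _ : Fin m => μ).map (distMatMap m)

/-- The distance matrix measure of order `2`, viewed as a measure on `ℝ`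
(the law of the distance of two independently sampled points). -/
noncomputable def nu2 {X : Type*} [MeasurableSpace X] [MetricSpace X]
    (μ : Measure X) : Measure ℝ :=
  (μ.prod μ).map fun p : X × X => dist p.1 p.2

/-- `∫ (1 - e^{-λ r}) ν^{2,(X,r,μ)}(dr)`. -/
noncomputable def nu2Int {X : Type*} [MeasurableSpace X] [MetricSpace X]
    (l : ℝ) (μ : Measure X) : ℝ :=
  ∫ r, (1 - Real.exp (-l * r)) ∂(nu2 μ)

/-- A metric measure space: a complete separable metric space together with a finite
Borel measure. -/
structure MM : Type 1 where
  carrier : Type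
  ms : MeasurableSpace carrier
  met : MetricSpace carrier
  sep : SecondCountableTopology carrier
  cmp : CompleteSpace carrier
  bor : BorelSpace carrier
  μ : Measure carrier
  fin : IsFiniteMeasure μ

attribute [instance] MM.ms MM.met MM.sep MM.cmp MM.bor MM.fin

/-- Gromov-weak convergence of a sequence of mm spaces: convergence of total masses and
of all integrals of bounded continuous test functions against the distance matrix
measures of every order `m ≥ 2`. -/
def GromovWeakTendsto (Z : ℕ → MM) (W : MM) : Prop :=
  Tendsto (fun n => (Z n).μ Set.univ) atTop (nhds (W.μ Set.univ)) ∧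
  ∀ m : ℕ, 2 ≤ m → ∀ φ : (DIdx m → ℝ) → ℝ, Continuous φ → (∃ C : ℝ, ∀ v, |φ v| ≤ C) →
    Tendsto (fun n => ∫ v, φ v ∂(nuM (Z n).μ m)) atTop (nhds (∫ v, φ v ∂(nuM W.μ m)))

/-- `Q` is a coupling of `μX` and `μY`. -/
def IsCoupling {X Y : Type*} [MeasurableSpace X] [MeasurableSpace Y]
    (μX : Measure X) (μY : Measure Y) (Q : Measure (X × Y)) : Prop :=
  Q.map Prod.fst = μX ∧ Q.map Prod.snd = μY

/-- The Eurandom cost `∬ |e^{-λ r_Y(y,y')} - e^{-λ r_X(x,x')}| Q(d(x,y)) Q(d(x',y'))`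
of a coupling `Q`. -/
noncomputable def eurCost {X Y : Type*} [MeasurableSpace X] [MetricSpace X]
    [MeasurableSpace Y] [MetricSpace Y] (l : ℝ) (Q : Measure (X × Y)) : ℝ :=
  ∫ p, |Real.exp (-l * dist p.1.2 p.2.2) - Real.exp (-l * dist p.1.1 p.2.1)| ∂(Q.prod Q)

/-- The Eurandom distance `dEur^λ`: the infimum of the Eurandom cost over all couplings. -/
noncomputable def dEur {X Y : Type*} [MeasurableSpace X] [MetricSpace X]
    [MeasurableSpace Y] [MetricSpace Y] (l : ℝ) (μX : Measure X) (μY : Measure Y) : ℝ :=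
  sInf {c : ℝ | ∃ Q : Measure (X × Y), IsCoupling μX μY Q ∧ c = eurCost l Q}

/-- The generalized Eurandom distance `dgEur^λ`. -/
noncomputable def dgEur {X Y : Type*} [MeasurableSpace X] [MetricSpace X]
    [MeasurableSpace Y] [MetricSpace Y] (l : ℝ) (μX : Measure X) (μY : Measure Y) : ℝ :=
  sInf {c : ℝ | ∃ (μX' : Measure X) (μY' : Measure Y), μX' ≤ μX ∧ μY' ≤ μY ∧
    μX' Set.univ = μY' Set.univ ∧
    c = ((nu2Int l μX - nu2Int l μX') + (nu2Int l μY - nu2Int l μY')) + dEur l μX' μY'}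

/-- The metric `c · r` obtained by scaling a metric by a positive constant. -/
noncomputable def scaleMetric {X : Type*} (c : ℝ) (hc : 0 < c) (m : MetricSpace X) :
    MetricSpace X where
  dist x y := c * m.dist x y
  dist_self x := by simp [m.dist_self]
  dist_comm x y := by simp [m.dist_comm x y]
  dist_triangle x y z := by
    show c * m.dist x z ≤ c * m.dist x y + c * m.dist y z
    have h := mul_le_mul_of_nonneg_left (m.dist_triangle x y z) hc.le
    linarith
  eq_of_dist_eq_zero := by
    intro x y h
    have h' : c * m.dist x y = 0 := h
    exact m.eq_of_dist_eq_zero (by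
      rcases mul_eq_zero.1 h' with h'' | h''
      · exact absurd h'' hc.ne'
      · exact h'')

/-- The `ℓ¹`-sum metric `r_X ⊕ r_Z` on a product space. -/
noncomputable def sumMetric {X Z : Type*} (mX : MetricSpace X) (mZ : MetricSpace Z) :
    MetricSpace (X × Z) where
  dist p q := mX.dist p.1 q.1 + mZ.dist p.2 q.2
  dist_self p := by simp [mX.dist_self, mZ.dist_self]
  dist_comm p q := by simp [mX.dist_comm p.1 q.1, mZ.dist_comm p.2 q.2]
  dist_triangle p q s := by
    show mX.dist p.1 s.1 + mZ.dist p.2 s.2 ≤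
      (mX.dist p.1 q.1 + mZ.dist p.2 q.2) + (mX.dist q.1 s.1 + mZ.dist q.2 s.2)
    have h1 := mX.dist_triangle p.1 q.1 s.1
    have h2 := mZ.dist_triangle p.2 q.2 s.2
    linarith
  eq_of_dist_eq_zero := by
    intro p q h
    have h' : mX.dist p.1 q.1 + mZ.dist p.2 q.2 = 0 := h
    have n1 := @dist_nonneg _ mX.toPseudoMetricSpace p.1 q.1
    have n2 := @dist_nonneg _ mZ.toPseudoMetricSpace p.2 q.2
    exact Prod.ext (mX.eq_of_dist_eq_zero (by linarith)) (mZ.eq_of_dist_eq_zero (by linarith))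

/-- The modulus of mass distribution `v_δ`. -/
noncomputable def vDelta {X : Type*} [MeasurableSpace X] [MetricSpace X]
    (μ : Measure X) (δ : ℝ) : ℝ :=
  sInf {ε : ℝ | 0 < ε ∧ μ {x : X | μ (Metric.ball x ε) ≤ ENNReal.ofReal δ} < ENNReal.ofReal ε}

/-- `P` is the countable product `μ^{⊗ ℕ}` of the probability measure `μ`, characterized
by its values on measurable cylinder sets. -/
def IsInfiniteProduct {X : Type*} [MeasurableSpace X] (μ : Measure X)
    (P : Measure (ℕ → X)) : Prop :=
  IsProbabilityMeasure P ∧ ∀ (s : Finset ℕ) (A : ℕ → Set X), (∀ i, MeasurableSet (A i)) →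
    P {f : ℕ → X | ∀ i ∈ s, f i ∈ A i} = ∏ i ∈ s, μ (A i)

/-- Index set for the entries of the infinite distance matrix: pairs `(i, j)` of
naturals with `i < j`. -/
def NIdx : Type := {p : ℕ × ℕ // p.1 < p.2}

instance : MeasurableSpace (NIdx → ℝ) := by unfold NIdx; infer_instance
instance : PartialOrder (NIdx → ℝ) := by unfold NIdx; infer_instance

/-- The infinite distance matrix map. -/
def distMatMapInf {X : Type*} [MetricSpace X] (x : ℕ → X) : NIdx → ℝ :=
  fun p => dist (x p.val.1) (x p.val.2)

/-- The simple graph on `Fin n` determined by a family of edge indicators indexed by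
the pairs `i < j`. -/
def graphOf {n : ℕ} (b : DIdx n → Bool) : SimpleGraph (Fin n) :=
  SimpleGraph.fromRel fun i j => ∃ e : DIdx n, (e.val = (i, j) ∨ e.val = (j, i)) ∧ b e = true

/-- Graph distance with the convention that points in different connected components
are at distance `n`. -/
noncomputable def graphDist {n : ℕ} (g : SimpleGraph (Fin n)) (i j : Fin n) : ℝ :=
  @ite ℝ (g.Reachable i j) (Classical.dec _) (g.dist i j : ℝ) (n : ℝ)


section helpers

variable {X Y : Type*} [MeasurableSpace X] [MetricSpace X] [SecondCountableTopology X]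
  [BorelSpace X] [MeasurableSpace Y] [MetricSpace Y] [SecondCountableTopology Y] [BorelSpace Y]

lemma aux_integrable {Z : Type*} [MeasurableSpace Z] (R : Measure Z) [IsFiniteMeasure R]
    (l : ℝ) (hl : 0 < l) (f g : Z → X) (hf : Measurable f) (hg : Measurable g) :
    Integrable (fun p => Real.exp (-l * dist (f p) (g p))) R := by
  refine Integrable.of_bound (C := 1) ?_ ?_
  · exact (Real.measurable_exp.comp ((hf.dist hg).const_mul (-l))).aestronglyMeasurable
  · refine Eventually.of_forall fun p => ?_
    rw [Real.norm_eq_abs, abs_of_pos (Real.exp_pos _), Real.exp_le_one_iff]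
    nlinarith [dist_nonneg (x := f p) (y := g p)]

lemma aux_map {Z : Type*} [MeasurableSpace Z] (R : Measure Z) [IsFiniteMeasure R]
    (f : Z → X) (hf : Measurable f) (F : X × X → ℝ) (hF : Measurable F) :
    ∫ p, F p ∂((R.map f).prod (R.map f)) = ∫ p, F (f p.1, f p.2) ∂(R.prod R) := by
  rw [Measure.map_prod_map R R hf hf, integral_map (hf.prodMap hf).aemeasurable
    hF.aestronglyMeasurable]
  rfl

lemma aux_meas (l : ℝ) : Measurable (fun p : X × X => Real.exp (-l * dist p.1 p.2)) :=
  Real.measurable_exp.comp (measurable_dist.const_mul (-l))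

lemma aux_prob {μX : Measure X} [IsProbabilityMeasure μX] {μY : Measure Y} {R : Measure (X × Y)}
    (hR : IsCoupling μX μY R) : IsProbabilityMeasure R := by
  constructor
  have h : μX Set.univ = 1 := measure_univ
  rw [← hR.1, Measure.map_apply measurable_fst MeasurableSet.univ] at h
  simpa using h

lemma aux_lower (l : ℝ) (hl : 0 < l) (μX : Measure X) [IsProbabilityMeasure μX] (μY : Measure Y)
    (R : Measure (X × Y)) (hR : IsCoupling μX μY R) :
    |∫ p, Real.exp (-l * dist p.1 p.2) ∂(μY.prod μY) -
      ∫ p, Real.exp (-l * dist p.1 p.2) ∂(μX.prod μX)| ≤ eurCost l R := by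
  haveI := aux_prob hR
  rw [← hR.1, ← hR.2, aux_map R Prod.fst measurable_fst _ (aux_meas l),
    aux_map R Prod.snd measurable_snd _ (aux_meas l), ← integral_sub]
  · exact abs_integral_le_integral_abs
  · exact aux_integrable _ l hl _ _ (by fun_prop) (by fun_prop)
  · exact aux_integrable _ l hl _ _ (by fun_prop) (by fun_prop)

lemma aux_dEur (l : ℝ) (hl : 0 < l) (μX : Measure X) [IsProbabilityMeasure μX] (μY : Measure Y)
    (R : Measure (X × Y)) (hR : IsCoupling μX μY R)
    (h : eurCost l R = |∫ p, Real.exp (-l * dist p.1 p.2) ∂(μY.prod μY) -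
      ∫ p, Real.exp (-l * dist p.1 p.2) ∂(μX.prod μX)|) : dEur l μX μY = eurCost l R := by
  apply IsLeast.csInf_eq
  refine ⟨⟨R, hR, rfl⟩, ?_⟩
  rintro c ⟨R', hR', rfl⟩
  rw [h]
  exact aux_lower l hl μX μY R' hR'

lemma aux_meas_cost (l : ℝ) : Measurable (fun p : (X × Y) × (X × Y) =>
    |Real.exp (-l * dist p.1.2 p.2.2) - Real.exp (-l * dist p.1.1 p.2.1)|) := by
  have h1 : Measurable (fun p : (X × Y) × (X × Y) => dist p.1.2 p.2.2) :=
    Measurable.dist (by fun_prop) (by fun_prop)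
  have h2 : Measurable (fun p : (X × Y) × (X × Y) => dist p.1.1 p.2.1) :=
    Measurable.dist (by fun_prop) (by fun_prop)
  exact ((Real.measurable_exp.comp (h1.const_mul _)).sub
    (Real.measurable_exp.comp (h2.const_mul _))).abs

/-- Cost formula for a coupling carried by a map pair, with comparable distances. -/
lemma aux_formula {Z : Type*} [MeasurableSpace Z] (Q : Measure Z) [IsProbabilityMeasure Q]
    (l : ℝ) (hl : 0 < l) (f : Z → X) (g : Z → Y) (hf : Measurable f) (hg : Measurable g)
    (hc : (∀ p q, dist (f p) (f q) ≤ dist (g p) (g q)) ∨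
      (∀ p q, dist (g p) (g q) ≤ dist (f p) (f q))) :
    dEur l (Q.map f) (Q.map g) = ∫ p, |Real.exp (-l * dist (g p.1) (g p.2)) -
      Real.exp (-l * dist (f p.1) (f p.2))| ∂(Q.prod Q) := by
  haveI : IsProbabilityMeasure (Q.map f) := Measure.isProbabilityMeasure_map hf.aemeasurable
  have hfg : Measurable (fun z => (f z, g z)) := hf.prodMk hg
  have hcost : eurCost l (Q.map (fun z => (f z, g z))) =
      ∫ p, |Real.exp (-l * dist (g p.1) (g p.2)) -
      Real.exp (-l * dist (f p.1) (f p.2))| ∂(Q.prod Q) := by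
    unfold eurCost
    rw [aux_map Q _ hfg _ (aux_meas_cost l)]
  have i1 : Integrable (fun p : Z × Z => Real.exp (-l * dist (g p.1) (g p.2))) (Q.prod Q) :=
    aux_integrable _ l hl _ _ (by fun_prop) (by fun_prop)
  have i2 : Integrable (fun p : Z × Z => Real.exp (-l * dist (f p.1) (f p.2))) (Q.prod Q) :=
    aux_integrable _ l hl _ _ (by fun_prop) (by fun_prop)
  rw [← hcost]
  apply aux_dEur l hl
  · constructor
    · rw [Measure.map_map measurable_fst hfg]; rfl
    · rw [Measure.map_map measurable_snd hfg]; rfl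
  · rw [hcost, aux_map Q f hf _ (aux_meas l), aux_map Q g hg _ (aux_meas l), ← integral_sub i1 i2]
    rcases hc with hc | hc
    · have e : ∀ p : Z × Z, Real.exp (-l * dist (g p.1) (g p.2)) -
        Real.exp (-l * dist (f p.1) (f p.2)) ≤ 0 := fun p => by
        have := hc p.1 p.2
        rw [sub_nonpos, Real.exp_le_exp]; nlinarith
      rw [abs_of_nonpos (integral_nonpos e), ← integral_neg]
      exact integral_congr_ae (Eventually.of_forall fun p => abs_of_nonpos (e p))
    · have e : ∀ p : Z × Z, 0 ≤ Real.exp (-l * dist (g p.1) (g p.2)) -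
        Real.exp (-l * dist (f p.1) (f p.2)) := fun p => by
        have := hc p.1 p.2
        rw [sub_nonneg, Real.exp_le_exp]; nlinarith
      rw [abs_of_nonneg (integral_nonneg e)]
      exact integral_congr_ae (Eventually.of_forall fun p => abs_of_nonneg (e p))

end helpers

/-- if the coupling `Q` attains the infimum in the definition of
`dEur^λ(x₁, x₂)`, then with `z̄ = (X₁ × X₂, r̄, Q)` (max-metric, i.e. Mathlib's product
metric) one has `dEur^λ(x₁, x₂) = dEur^λ(x₁, z̄) + dEur^λ(z̄, x₂)`. -/
theorem stmt13 {X₁ X₂ : Type*} [MeasurableSpace X₁] [MetricSpace X₁] [SecondCountableTopology X₁] [CompleteSpace X₁] [BorelSpace X₁] [MeasurableSpace X₂] [MetricSpace X₂] [SecondCountableTopology X₂] [CompleteSpace X₂] [BorelSpace X₂]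
    (l : ℝ) (hl : 0 < l)
    (μ₁ : Measure X₁) (μ₂ : Measure X₂)
    [IsProbabilityMeasure μ₁] [IsProbabilityMeasure μ₂]
    (Q : Measure (X₁ × X₂)) (hQ : IsCoupling μ₁ μ₂ Q)
    (hopt : eurCost l Q = dEur l μ₁ μ₂) :
    dEur l μ₁ μ₂ = dEur l μ₁ Q + dEur l Q μ₂ := by
  haveI := aux_prob hQ
  have h1 := aux_formula Q l hl (Prod.fst : X₁ × X₂ → X₁) id measurable_fst measurable_id
    (Or.inl fun p q => by simp [Prod.dist_eq])
  have h2 := aux_formula Q l hl id (Prod.snd : X₁ × X₂ → X₂) measurable_id measurable_snd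
    (Or.inr fun p q => by simp [Prod.dist_eq])
  rw [Measure.map_id, hQ.1] at h1
  rw [Measure.map_id, hQ.2] at h2
  have i1 : Integrable (fun p : (X₁ × X₂) × (X₁ × X₂) => Real.exp (-l * dist p.1.1 p.2.1))
      (Q.prod Q) := aux_integrable _ l hl _ _ (by fun_prop) (by fun_prop)
  have i2 : Integrable (fun p : (X₁ × X₂) × (X₁ × X₂) => Real.exp (-l * dist p.1.2 p.2.2))
      (Q.prod Q) := aux_integrable _ l hl _ _ (by fun_prop) (by fun_prop)
  have i3 : Integrable (fun p : (X₁ × X₂) × (X₁ × X₂) => Real.exp (-l * dist (id p.1) (id p.2)))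
      (Q.prod Q) := aux_integrable _ l hl _ _ (by fun_prop) (by fun_prop)
  rw [h1, h2, ← hopt]
  refine Eq.trans ?_ (integral_add (i3.sub i1).abs (i2.sub i3).abs)
  unfold eurCost
  refine integral_congr_ae (Eventually.of_forall fun p => ?_)
  simp only [id, Pi.sub_apply, Prod.dist_eq]
  rcases le_total (dist p.1.1 p.2.1) (dist p.1.2 p.2.2) with h | h
  · rw [max_eq_right h]; simp
  · rw [max_eq_left h]; simp

end MMOrder
end

section
/- Let λ > 0, let (X₁, r₁, μ₁) and (X₂, r₂, μ₂) be probability mm spaces, let Q be a coupling of μ₁ and μ₂ attaining the infimum in the definition of dEur^λ((X₁,r₁,μ₁),(X₂,r₂,μ₂)), and let z̄ := (X₁ × X₂, r̄, Q) with r̄((x₁,x₂),(x₁',x₂')) := max(r₁(x₁,x₁'), r₂(x₂,x₂')). Let (X₃, r₃, μ₃) be a probability mm space with (X₁, r₁, μ₁) ≼_metric (X₃, r₃, μ₃) and (X₂, r₂, μ₂) ≼_metric (X₃, r₃, μ₃). If (X₃, r₃, μ₃) ≼_metric z̄, then (X₃, r₃, μ₃) and z̄ are equivalent. -/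
open MeasureTheory Metric Filter Topology

namespace MMOrder

theorem msupp_ae {X : Type*} [MeasurableSpace X] [MetricSpace X] [SecondCountableTopology X]
    (μ : Measure X) : ∀ᵐ x ∂μ, x ∈ msupp μ := by
  have h := Measure.support_mem_ae (μ := μ)
  filter_upwards [h] with x hx ε hε
  exact (Measure.mem_support_iff_forall x).1 hx _ (Metric.ball_mem_nhds x hε)

theorem msupp_closed {X : Type*} [MeasurableSpace X] [MetricSpace X]
    (μ : Measure X) : IsClosed (msupp μ) := by
  rw [← closure_subset_iff_isClosed]
  intro x hx ε hε
  obtain ⟨y, hy, hxy⟩ := Metric.mem_closure_iff.1 hx (ε / 2) (by positivity)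
  refine lt_of_lt_of_le (hy (ε / 2) (by positivity)) (measure_mono ?_)
  apply Metric.ball_subset_ball'
  rw [dist_comm y x]; linarith

theorem expdist_integrable {Z W : Type*} [MeasurableSpace Z] [MeasurableSpace W]
    [MetricSpace W] [SecondCountableTopology W] [BorelSpace W]
    (l : ℝ) (hl : 0 < l) (f : Z → W) (hf : Measurable f) (P : Measure Z) [IsProbabilityMeasure P] :
    Integrable (fun p : Z × Z => Real.exp (-l * dist (f p.1) (f p.2))) (P.prod P) := by
  have hm : Measurable (fun p : Z × Z => Real.exp (-l * dist (f p.1) (f p.2))) := by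
    have := (hf.comp measurable_fst).dist (hf.comp measurable_snd : Measurable (fun p : Z × Z => _))
    exact Real.measurable_exp.comp (this.const_mul (-l))
  refine Integrable.of_bound hm.aestronglyMeasurable 1 (Eventually.of_forall fun p => ?_)
  rw [Real.norm_eq_abs, abs_of_pos (Real.exp_pos _), Real.exp_le_one_iff]
  have := mul_nonneg hl.le (dist_nonneg (x := f p.1) (y := f p.2))
  linarith

theorem expdist_map {Z W : Type*} [MeasurableSpace Z] [MeasurableSpace W]
    [MetricSpace W] [SecondCountableTopology W] [BorelSpace W]
    (l : ℝ) (f : Z → W) (hf : Measurable f) (P : Measure Z) [IsProbabilityMeasure P] :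
    ∫ p, Real.exp (-l * dist p.1 p.2) ∂((P.map f).prod (P.map f)) =
    ∫ p, Real.exp (-l * dist (f p.1) (f p.2)) ∂(P.prod P) := by
  have hc : Continuous (fun p : W × W => Real.exp (-l * dist p.1 p.2)) := by fun_prop
  rw [Measure.map_prod_map P P hf hf, integral_map (hf.prodMap hf).aemeasurable
    hc.measurable.aestronglyMeasurable]
  rfl

theorem eurCost_formula {X Y : Type*} [MeasurableSpace X] [MetricSpace X]
    [SecondCountableTopology X] [BorelSpace X]
    [MeasurableSpace Y] [MetricSpace Y] [SecondCountableTopology Y] [BorelSpace Y]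
    (l : ℝ) (hl : 0 < l) (μ : Measure X) (ν : Measure Y) (Q : Measure (X × Y))
    [IsProbabilityMeasure Q] (hQ : IsCoupling μ ν Q) :
    eurCost l Q = (∫ p, Real.exp (-l * dist p.1 p.2) ∂(ν.prod ν)) +
      (∫ p, Real.exp (-l * dist p.1 p.2) ∂(μ.prod μ)) -
      2 * ∫ p, Real.exp (-l * dist p.1 p.2) ∂(Q.prod Q) := by
  rw [← hQ.1, ← hQ.2, expdist_map l _ measurable_fst, expdist_map l _ measurable_snd]
  have i1 := expdist_integrable l hl (Prod.fst : X × Y → X) measurable_fst Q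
  have i2 := expdist_integrable l hl (Prod.snd : X × Y → Y) measurable_snd Q
  have i3 := expdist_integrable l hl (id : X × Y → X × Y) measurable_id Q
  simp only [id] at i3
  have i21 : Integrable (fun p : (X × Y) × (X × Y) => Real.exp (-l * dist p.1.2 p.2.2) +
      Real.exp (-l * dist p.1.1 p.2.1)) (Q.prod Q) := i2.add i1
  rw [← integral_const_mul, ← integral_add i2 i1, ← integral_sub i21 (i3.const_mul 2)]
  unfold eurCost
  congr 1
  ext p
  have hd : dist p.1 p.2 = max (dist p.1.1 p.2.1) (dist p.1.2 p.2.2) := rfl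
  rw [hd]
  rcases le_total (dist p.1.1 p.2.1) (dist p.1.2 p.2.2) with h | h
  · rw [max_eq_right h]
    have : Real.exp (-l * dist p.1.2 p.2.2) ≤ Real.exp (-l * dist p.1.1 p.2.1) :=
      Real.exp_le_exp.2 (by nlinarith)
    rw [abs_of_nonpos (by linarith)]; ring
  · rw [max_eq_left h]
    have : Real.exp (-l * dist p.1.1 p.2.1) ≤ Real.exp (-l * dist p.1.2 p.2.2) :=
      Real.exp_le_exp.2 (by nlinarith)
    rw [abs_of_nonneg (by linarith)]; ring

/-- with `z̄ = (X₁ × X₂, r̄, Q)` built from an optimal Eurandom coupling `Q`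
(max-metric, i.e. Mathlib's product metric): if `(X₃, r₃, μ₃)` dominates both `x₁` and `x₂`
in the `≼_metric` order and `x₃ ≼_metric z̄`, then `x₃` and `z̄` are equivalent. -/
theorem stmt14 {X₁ X₂ X₃ : Type*} [MeasurableSpace X₁] [MetricSpace X₁] [SecondCountableTopology X₁] [CompleteSpace X₁] [BorelSpace X₁] [MeasurableSpace X₂] [MetricSpace X₂] [SecondCountableTopology X₂] [CompleteSpace X₂] [BorelSpace X₂] [MeasurableSpace X₃] [MetricSpace X₃] [SecondCountableTopology X₃] [CompleteSpace X₃] [BorelSpace X₃]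
    (l : ℝ) (hl : 0 < l)
    (μ₁ : Measure X₁) (μ₂ : Measure X₂) (μ₃ : Measure X₃)
    [IsProbabilityMeasure μ₁] [IsProbabilityMeasure μ₂] [IsProbabilityMeasure μ₃]
    (Q : Measure (X₁ × X₂)) (hQ : IsCoupling μ₁ μ₂ Q)
    (hopt : eurCost l Q = dEur l μ₁ μ₂)
    (h1 : LeMetric μ₁ μ₃) (h2 : LeMetric μ₂ μ₃)
    (h3 : LeMetric μ₃ Q) :
    MMEquiv μ₃ Q := by
  obtain ⟨τ₁, m1, s1, e1, d1⟩ := h1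
  obtain ⟨τ₂, m2, s2, e2, d2⟩ := h2
  obtain ⟨σ, m3, s3, e3, d3⟩ := h3
  have pQ : IsProbabilityMeasure Q := by
    constructor
    have := congrArg (fun m => m Set.univ) hQ.1
    simpa [Measure.map_apply measurable_fst MeasurableSet.univ] using this
  have mφ : Measurable (fun x => (τ₁ x, τ₂ x)) := m1.prodMk m2
  set φ : X₃ → X₁ × X₂ := fun x => (τ₁ x, τ₂ x) with hφ
  have mψ : Measurable (φ ∘ σ) := mφ.comp m3
  have pQ' : IsProbabilityMeasure (Q.map (φ ∘ σ)) := Measure.isProbabilityMeasure_map mψ.aemeasurable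
  have eQ' : Q.map (φ ∘ σ) = μ₃.map φ := by rw [← Measure.map_map mφ m3, e3]
  have cQ' : IsCoupling μ₁ μ₂ (Q.map (φ ∘ σ)) := by
    rw [eQ']
    constructor
    · rw [Measure.map_map measurable_fst mφ]; exact e1
    · rw [Measure.map_map measurable_snd mφ]; exact e2
  have hle : eurCost l Q ≤ eurCost l (Q.map (φ ∘ σ)) := by
    rw [hopt]
    refine csInf_le ⟨0, ?_⟩ ⟨_, cQ', rfl⟩
    rintro c ⟨R, -, rfl⟩
    exact integral_nonneg fun p => abs_nonneg _
  rw [eurCost_formula l hl _ _ _ hQ, eurCost_formula l hl _ _ _ cQ', expdist_map l _ mψ] at hle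
  have hφd : ∀ x ∈ msupp μ₃, ∀ y ∈ msupp μ₃, dist (φ x) (φ y) ≤ dist x y :=
    fun x hx y hy => max_le (d1 x hx y hy) (d2 x hx y hy)
  have hae : ∀ᵐ p ∂(Q.prod Q), p.1 ∈ msupp Q ∧ p.2 ∈ msupp Q :=
    (Measure.quasiMeasurePreserving_fst.ae (msupp_ae Q)).and
      (Measure.quasiMeasurePreserving_snd.ae (msupp_ae Q))
  have iF := expdist_integrable l hl (id : X₁ × X₂ → X₁ × X₂) measurable_id Q
  have iG := expdist_integrable l hl _ mψ Q
  simp only [id] at iF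
  have hFG : (fun p : (X₁ × X₂) × (X₁ × X₂) => Real.exp (-l * dist p.1 p.2)) ≤ᵐ[Q.prod Q]
      (fun p => Real.exp (-l * dist ((φ ∘ σ) p.1) ((φ ∘ σ) p.2))) := by
    filter_upwards [hae] with p hp
    have a := hφd _ (s3 hp.1) _ (s3 hp.2)
    have b := d3 _ hp.1 _ hp.2
    apply Real.exp_le_exp.2
    have := mul_le_mul_of_nonneg_left (a.trans b) hl.le
    simp only [Function.comp]
    linarith
  have heq := (integral_eq_iff_of_ae_le iF iG hFG).1
    (le_antisymm (integral_mono_ae iF iG hFG) (by linarith))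
  have hiso : ∀ z ∈ msupp Q, ∀ z' ∈ msupp Q, dist (σ z) (σ z') = dist z z' := by
    intro z hz z' hz'
    refine le_antisymm (d3 z hz z' hz') (le_of_forall_pos_le_add fun ε hε => ?_)
    have hpos : (Q.prod Q) (ball z (ε / 4) ×ˢ ball z' (ε / 4)) ≠ 0 := by
      rw [Measure.prod_prod]
      exact mul_ne_zero (hz _ (by positivity)).ne' (hz' _ (by positivity)).ne'
    have hfr : ∃ᵐ p ∂(Q.prod Q), p ∈ ball z (ε / 4) ×ˢ ball z' (ε / 4) :=
      frequently_ae_mem_iff.2 hpos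
    obtain ⟨⟨w, w'⟩, ⟨hw, hw'⟩, ⟨hs, hs'⟩, he⟩ := (hfr.and_eventually (hae.and heq)).exists
    simp only [Function.comp, Real.exp_eq_exp] at he hw hw' hs hs'
    have he' := mul_left_cancel₀ (neg_ne_zero.2 hl.ne') he
    have a := hφd _ (s3 hs) _ (s3 hs')
    have b1 := d3 _ hs _ hz
    have b2 := d3 _ hs' _ hz'
    rw [mem_ball] at hw hw'
    have t1 := dist_triangle4 z w w' z'
    have t2 := dist_triangle4 (σ w) (σ z) (σ z') (σ w')
    rw [dist_comm z w] at t1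
    rw [dist_comm (σ z') (σ w')] at t2
    linarith
  set S := msupp Q with hS
  have cS : IsClosed S := msupp_closed Q
  have isoS : Isometry (S.domRestrict σ) :=
    Isometry.of_dist_eq fun a b => hiso a a.2 b b.2
  have cT : IsClosed (σ '' S) := by
    have : CompleteSpace S := cS.completeSpace_coe
    have h := isoS.isClosedEmbedding.isClosed_range
    rwa [Set.range_domRestrict] at h
  have hsub : msupp μ₃ ⊆ σ '' S := by
    intro x hx
    by_contra hn
    obtain ⟨ε, hε, hb⟩ := Metric.isOpen_iff.1 cT.isOpen_compl x hn
    have h0 : μ₃ (σ '' S)ᶜ = 0 := by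
      rw [← e3, Measure.map_apply m3 cT.isOpen_compl.measurableSet]
      have h := msupp_ae Q
      rw [ae_iff] at h
      refine measure_mono_null ?_ h
      intro z hz hzS
      exact hz ⟨z, hzS, rfl⟩
    exact (hx ε hε).ne' (measure_mono_null hb h0)
  obtain ⟨z₀⟩ : Nonempty (X₁ × X₂) := nonempty_of_isProbabilityMeasure Q
  classical
  have : Nonempty (X₁ × X₂) := ⟨z₀⟩
  let ι : X₃ → X₁ × X₂ := Function.invFunOn σ S
  have hι : ∀ x ∈ σ '' S, ι x ∈ S ∧ σ (ι x) = x := fun x hx =>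
    ⟨Function.invFunOn_mem hx, Function.invFunOn_eq hx⟩
  have dι : ∀ x ∈ σ '' S, ∀ y ∈ σ '' S, dist (ι x) (ι y) = dist x y := by
    intro x hx y hy
    rw [← hiso _ (hι x hx).1 _ (hι y hy).1, (hι x hx).2, (hι y hy).2]
  have cι : ContinuousOn ι (σ '' S) := by
    rw [continuousOn_iff_continuous_domRestrict]
    have h : Isometry ((σ '' S).domRestrict ι) :=
      Isometry.of_dist_eq fun a b => dι a a.2 b b.2
    exact h.continuous
  have mΦ : Measurable ((σ '' S).piecewise ι (fun _ => z₀)) :=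
    cι.measurable_piecewise continuousOn_const cT.measurableSet
  refine ⟨_, mΦ, ?_, ?_⟩
  · rw [← e3, Measure.map_map mΦ m3]
    conv_rhs => rw [← Measure.map_id (μ := Q)]
    apply Measure.map_congr
    filter_upwards [msupp_ae Q] with z hz
    have hm : σ z ∈ σ '' S := ⟨z, hz, rfl⟩
    simp only [Function.comp, Set.piecewise_eq_of_mem _ _ _ hm, id]
    rw [← dist_eq_zero, ← hiso _ (hι _ hm).1 _ hz, (hι _ hm).2, dist_self]
  · intro x hx y hy
    rw [Set.piecewise_eq_of_mem _ _ _ (hsub hx), Set.piecewise_eq_of_mem _ _ _ (hsub hy)]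
    exact dι x (hsub hx) y (hsub hy)

end MMOrder
end
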